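/- arXiv:2403.04585 — 5 statements merged into one kernel-verified Lean document; each statement's English description precedes it below -/
import Mathlib

section
/- Let d ≥ 1 and let ρ : ℝ → Matrix d d ℂ be a family of Hermitian matrices, differentiable at θ₀, with ρ(θ₀) ≠ 0. Regard Matrix d d ℂ as a Hilbert space with the Frobenius inner product ⟨A,B⟩ = Tr(A†B), define the associated state ρ̃(θ) as the linear operator on this space given by ρ̃(θ)(M) = (⟨ρ(θ),M⟩/Tr(ρ(θ)²))·ρ(θ) (the rank-one orthogonal projection onto the span of ρ(θ)), and set L := 2·(d/dθ)ρ̃ evaluated at θ₀. Then: (i) L satisfies the symmetric-logarithmic-derivative equation 2·ρ̃'(θ₀) = ρ̃(θ₀)∘L + L∘ρ̃(θ₀); and (ii) the associated quantum Fisher information satisfies Tr(ρ̃(θ₀)∘L∘L) = 4·[ Tr(ρ̇(θ₀)²)/Tr(ρ(θ₀)²) − ( Tr(ρ(θ₀)·ρ̇(θ₀)) / Tr(ρ(θ₀)²) )² ], where the trace on the left is the trace of an operator on the d²-dimensional space of matrices. -/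
open Matrix
open scoped ComplexConjugate

noncomputable section

attribute [local instance] Matrix.frobeniusNormedAddCommGroup Matrix.frobeniusNormedSpace

/-- Row-stacking vectorization of a matrix. -/
def vecM {d : ℕ} (X : Matrix (Fin d) (Fin d) ℂ) : Fin d × Fin d → ℂ :=
  fun p => X p.1 p.2

/-- The associated state `ρ̃` of a (Hermitian) matrix `ρ`, viewed as a linear operator on the
`d²`-dimensional Hilbert space of matrices (with the Frobenius inner product
`⟨A,B⟩ = Tr(AᴴB)`), represented as a matrix acting on vectorized matrices:
`ρ̃(M) = (⟨ρ,M⟩ / Tr(ρ²)) • ρ`, the rank-one orthogonal projection onto the span of `ρ`. -/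
def assocState {d : ℕ} (ρ : Matrix (Fin d) (Fin d) ℂ) :
    Matrix (Fin d × Fin d) (Fin d × Fin d) ℂ :=
  ((ρ * ρ).trace)⁻¹ • vecMulVec (vecM ρ) (star (vecM ρ))

/-- The Frobenius inner product `⟨A, B⟩ = Tr(AᴴB)` in vectorized form, for Hermitian `A`. -/
theorem star_vecM_dotProduct_vecM {d : ℕ} {A : Matrix (Fin d) (Fin d) ℂ} (hA : A.IsHermitian)
    (B : Matrix (Fin d) (Fin d) ℂ) : star (vecM A) ⬝ᵥ vecM B = (A * B).trace := by
  conv_rhs => rw [← hA.eq]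
  simp only [dotProduct, trace, diag_apply, mul_apply, conjTranspose_apply, vecM,
    Fintype.sum_prod_type, Pi.star_apply]
  exact Finset.sum_comm

open scoped ComplexOrder in
theorem trace_mul_self_ne_zero_of_isHermitian {d : ℕ} {A : Matrix (Fin d) (Fin d) ℂ}
    (hA : A.IsHermitian) (hne : A ≠ 0) : (A * A).trace ≠ 0 := by
  intro h
  nth_rewrite 1 [← hA.eq] at h
  exact hne (trace_conjTranspose_mul_self_eq_zero_iff.1 h)

theorem HasDerivAt.matrix_apply {m n : Type*} [Fintype m] [Fintype n]
    {A : ℝ → Matrix m n ℂ} {A' : Matrix m n ℂ} {t : ℝ} (hA : HasDerivAt A A' t) (i : m) (j : n) :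
    HasDerivAt (fun x => A x i j) (A' i j) t := by
  exact hasDerivAt_pi.1 (hasDerivAt_pi.1 hA i) j

theorem hasDerivAt_matrix_of_apply {m n : Type*} [Fintype m] [Fintype n]
    {A : ℝ → Matrix m n ℂ} {A' : Matrix m n ℂ} {t : ℝ}
    (hA : ∀ i j, HasDerivAt (fun x => A x i j) (A' i j) t) : HasDerivAt A A' t := by
  exact hasDerivAt_pi.2 fun i => hasDerivAt_pi.2 (hA i)

/-- The derivative of a family of Hermitian matrices is Hermitian. -/
theorem HasDerivAt.isHermitian {d : ℕ} {ρ : ℝ → Matrix (Fin d) (Fin d) ℂ}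
    {ρ' : Matrix (Fin d) (Fin d) ℂ} {t : ℝ} (hρ : HasDerivAt ρ ρ' t)
    (hherm : ∀ x, (ρ x).IsHermitian) : ρ'.IsHermitian := by
  ext i j
  refine HasDerivAt.unique (f := fun x => ρ x i j) ?_ (hρ.matrix_apply i j)
  have h := (hρ.matrix_apply j i).star
  exact h.congr_of_eventuallyEq (Filter.Eventually.of_forall fun x => ((hherm x).apply i j).symm)

theorem HasDerivAt.trace_mul_self {d : ℕ} {ρ : ℝ → Matrix (Fin d) (Fin d) ℂ}
    {ρ' : Matrix (Fin d) (Fin d) ℂ} {t : ℝ} (hρ : HasDerivAt ρ ρ' t) :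
    HasDerivAt (fun x => (ρ x * ρ x).trace) (2 * (ρ t * ρ').trace) t := by
  have h : HasDerivAt (fun x => ∑ i, ∑ j, ρ x i j * ρ x j i)
      (∑ i, ∑ j, (ρ' i j * ρ t j i + ρ t i j * ρ' j i)) t :=
    HasDerivAt.fun_sum fun i _ => HasDerivAt.fun_sum fun j _ =>
      (hρ.matrix_apply i j).mul (hρ.matrix_apply j i)
  have e : 2 * (ρ t * ρ').trace = ∑ i, ∑ j, (ρ' i j * ρ t j i + ρ t i j * ρ' j i) := by
    simp only [Finset.sum_add_distrib]
    rw [two_mul]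
    nth_rewrite 1 [trace_mul_comm]
    rfl
  rw [e]
  exact h

/-- The derivative of the associated state along a differentiable Hermitian family. -/
theorem HasDerivAt.assocState {d : ℕ} {ρ : ℝ → Matrix (Fin d) (Fin d) ℂ}
    {ρ' : Matrix (Fin d) (Fin d) ℂ} {t : ℝ} (hρ : HasDerivAt ρ ρ' t)
    (hs : (ρ t * ρ t).trace ≠ 0) :
    HasDerivAt (fun x => assocState (ρ x))
      ((-(2 * (ρ t * ρ').trace) / (ρ t * ρ t).trace ^ 2) •
          vecMulVec (vecM (ρ t)) (star (vecM (ρ t))) +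
        ((ρ t * ρ t).trace)⁻¹ • (vecMulVec (vecM ρ') (star (vecM (ρ t))) +
          vecMulVec (vecM (ρ t)) (star (vecM ρ')))) t :=
  hasDerivAt_matrix_of_apply fun p q =>
    (hρ.trace_mul_self.inv hs).mul
      ((hρ.matrix_apply p.1 p.2).mul (hρ.matrix_apply q.1 q.2).star)

/-- For a differentiable family of Hermitian matrices `ρ θ` with `ρ θ₀ ≠ 0`,
setting `L := 2 (d/dθ) ρ̃` at `θ₀`, we have (i) the SLD equation
`2 ρ̃' = ρ̃ ∘ L + L ∘ ρ̃`, and (ii)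
`Tr(ρ̃ ∘ L ∘ L) = 4 [ Tr(ρ̇²)/Tr(ρ²) − (Tr(ρ ρ̇)/Tr(ρ²))² ]`. -/
theorem associated_SLD_and_QFI {d : ℕ} (hd : 1 ≤ d) (θ₀ : ℝ)
    (ρ : ℝ → Matrix (Fin d) (Fin d) ℂ) (ρ' : Matrix (Fin d) (Fin d) ℂ)
    (hherm : ∀ θ, (ρ θ).IsHermitian)
    (hne : ρ θ₀ ≠ 0)
    (hρ : HasDerivAt ρ ρ' θ₀)
    (L : Matrix (Fin d × Fin d) (Fin d × Fin d) ℂ)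
    (hL : L = (2 : ℂ) • deriv (fun θ => assocState (ρ θ)) θ₀) :
    ((2 : ℂ) • deriv (fun θ => assocState (ρ θ)) θ₀
        = assocState (ρ θ₀) * L + L * assocState (ρ θ₀)) ∧
    (assocState (ρ θ₀) * L * L).trace =
      4 * ((ρ' * ρ').trace / (ρ θ₀ * ρ θ₀).trace
        - ((ρ θ₀ * ρ').trace / (ρ θ₀ * ρ θ₀).trace) ^ 2) := by
  have hs := trace_mul_self_ne_zero_of_isHermitian (hherm θ₀) hne
  have hρ' := hρ.isHermitian hherm
  have hvv := star_vecM_dotProduct_vecM (hherm θ₀) (ρ θ₀)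
  have hvw := star_vecM_dotProduct_vecM (hherm θ₀) ρ'
  have hwv := star_vecM_dotProduct_vecM hρ' (ρ θ₀)
  have hww := star_vecM_dotProduct_vecM hρ' ρ'
  rw [trace_mul_comm] at hwv
  have hderiv : deriv (fun θ => assocState (ρ θ)) θ₀ = _ := (hρ.assocState hs).deriv
  rw [hderiv] at hL ⊢
  subst hL
  unfold assocState
  generalize (ρ θ₀ * ρ θ₀).trace = s at *
  generalize (ρ θ₀ * ρ').trace = t at *
  generalize (ρ' * ρ').trace = u at *
  generalize vecM (ρ θ₀) = v at *
  generalize vecM ρ' = w at *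
  constructor
  · simp only [smul_add, mul_add, add_mul, smul_mul_assoc, mul_smul_comm, smul_smul,
      vecMulVec_mul_vecMulVec, vecMulVec_smul, hvv, hvw, hwv]
    match_scalars <;> field_simp <;> ring
  · simp only [smul_add, mul_add, add_mul, smul_mul_assoc, mul_smul_comm, smul_smul,
      vecMulVec_mul_vecMulVec, vecMulVec_smul, hvv, hvw, hwv, hww, trace_add, trace_smul,
      trace_vecMulVec, dotProduct_comm _ (star _), smul_eq_mul]
    field_simp
    ring

end
end

section
/- Let Kᵢ : ℝ → Matrix d d ℂ (i = 1,…,r) be differentiable at θ₀ and T(θ) := Σᵢ Kᵢ(θ) ⊗ conj(Kᵢ(θ)). Define the superoperator Φ on Matrix d d ℂ by Φ(X) := Σ_{i,j} [ (Kᵢ†K̇ⱼ)·X·(Kᵢ†Kⱼ)† + (Kᵢ†Kⱼ)·X·(Kᵢ†K̇ⱼ)† ], with all Kᵢ, K̇ᵢ evaluated at θ₀. Then: (i) for every X ∈ Matrix d d ℂ, T(θ₀)†·Ṫ(θ₀)·vec(X) = vec(Φ(X)); (ii) Φ(X†) = Φ(X)† for every X; and (iii) consequently, if Φ(R) = μ·R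 for some R ∈ Matrix d d ℂ and μ ∈ ℂ, then Φ(R†) = conj(μ)·R†, i.e. eigenmatrices of T†Ṫ come in adjoint pairs with conjugate eigenvalues. -/
open Matrix
open scoped Kronecker ComplexConjugate

noncomputable section

attribute [local instance] Matrix.frobeniusNormedAddCommGroup Matrix.frobeniusNormedSpace

/-- The transition matrix `T = Σᵢ Kᵢ ⊗ conj(Kᵢ)`. -/
def transit {d r : ℕ} (K : Fin r → Matrix (Fin d) (Fin d) ℂ) :
    Matrix (Fin d × Fin d) (Fin d × Fin d) ℂ :=
  ∑ i, K i ⊗ₖ (K i).map (starRingEnd ℂ)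

/-- Product rule for `t ↦ Kᵢ(t) ⊗ conj(Kᵢ(t))`, summed over `i`. -/
theorem hasDerivAt_transit {d r : ℕ} {θ₀ : ℝ}
    {K : Fin r → ℝ → Matrix (Fin d) (Fin d) ℂ} {K' : Fin r → Matrix (Fin d) (Fin d) ℂ}
    (hK : ∀ i, HasDerivAt (K i) (K' i) θ₀) :
    HasDerivAt (fun θ => transit (fun i => K i θ))
      (∑ i, (K' i ⊗ₖ (K i θ₀).map (starRingEnd ℂ) + K i θ₀ ⊗ₖ (K' i).map (starRingEnd ℂ)))
      θ₀ := by
  have entry : ∀ i a b, HasDerivAt (fun θ => K i θ a b) (K' i a b) θ₀ := fun i a b =>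
    hasDerivAt_pi.1 (hasDerivAt_pi.1 (hK i) a) b
  refine HasDerivAt.fun_sum fun i _ => ?_
  refine hasDerivAt_pi.2 fun p => hasDerivAt_pi.2 fun q => ?_
  exact (entry i p.1 q.1).mul (entry i p.2 q.2).star

/-- `(A ⊗ conj(B)) vec(X) = vec(A X B†)`. -/
theorem kronecker_map_conj_mulVec_vecM {d : ℕ} (A B X : Matrix (Fin d) (Fin d) ℂ) :
    (A ⊗ₖ B.map (starRingEnd ℂ)) *ᵥ vecM X = vecM (A * X * Bᴴ) := by
  ext ⟨a, b⟩
  simp only [mulVec, dotProduct, vecM, kroneckerMap_apply, map_apply, mul_apply,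
    conjTranspose_apply, Fintype.sum_prod_type, Finset.sum_mul, starRingEnd_apply]
  rw [Finset.sum_comm]
  exact Finset.sum_congr rfl fun _ _ => Finset.sum_congr rfl fun _ _ => by ring

/-- `(A ⊗ conj(B))† (C ⊗ conj(D)) = (A†C) ⊗ conj(B†D)`. -/
theorem conjTranspose_kronecker_map_conj_mul {d : ℕ} (A B C D : Matrix (Fin d) (Fin d) ℂ) :
    (A ⊗ₖ B.map (starRingEnd ℂ))ᴴ * (C ⊗ₖ D.map (starRingEnd ℂ)) =
      (Aᴴ * C) ⊗ₖ (Bᴴ * D).map (starRingEnd ℂ) := by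
  rw [conjTranspose_kronecker, ← mul_kronecker_mul, Matrix.map_mul]
  rfl

theorem vecM_add {d : ℕ} (X Y : Matrix (Fin d) (Fin d) ℂ) :
    vecM (X + Y) = vecM X + vecM Y := rfl

theorem vecM_sum {d : ℕ} {ι : Type*} (s : Finset ι) (f : ι → Matrix (Fin d) (Fin d) ℂ) :
    vecM (∑ i ∈ s, f i) = ∑ i ∈ s, vecM (f i) := by
  ext p
  simp [vecM, Matrix.sum_apply]

/-- With `Φ(X) = Σᵢⱼ (Kᵢ†K̇ⱼ) X (Kᵢ†Kⱼ)† + (Kᵢ†Kⱼ) X (Kᵢ†K̇ⱼ)†`: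
(i) `T† Ṫ vec(X) = vec(Φ(X))`; (ii) `Φ(X†) = Φ(X)†`; (iii) eigenmatrices of `T†Ṫ` come in
adjoint pairs with conjugate eigenvalues. -/
theorem transition_derivative_superoperator {d r : ℕ} (θ₀ : ℝ)
    (K : Fin r → ℝ → Matrix (Fin d) (Fin d) ℂ)
    (K' : Fin r → Matrix (Fin d) (Fin d) ℂ)
    (hK : ∀ i, HasDerivAt (K i) (K' i) θ₀)
    (Φ : Matrix (Fin d) (Fin d) ℂ → Matrix (Fin d) (Fin d) ℂ)
    (hΦ : Φ = fun X => ∑ i, ∑ j,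
      (((K i θ₀)ᴴ * K' j) * X * ((K i θ₀)ᴴ * K j θ₀)ᴴ
        + ((K i θ₀)ᴴ * K j θ₀) * X * ((K i θ₀)ᴴ * K' j)ᴴ)) :
    (∀ X : Matrix (Fin d) (Fin d) ℂ,
      ((transit (fun i => K i θ₀))ᴴ * deriv (fun θ => transit (fun i => K i θ)) θ₀)
        *ᵥ vecM X = vecM (Φ X)) ∧
    (∀ X : Matrix (Fin d) (Fin d) ℂ, Φ Xᴴ = (Φ X)ᴴ) ∧
    (∀ (R : Matrix (Fin d) (Fin d) ℂ) (μ : ℂ), Φ R = μ • R → Φ Rᴴ = conj μ • Rᴴ) := by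
  have adjoint_comm : ∀ X : Matrix (Fin d) (Fin d) ℂ, Φ Xᴴ = (Φ X)ᴴ := by
    intro X
    simp only [hΦ, conjTranspose_sum, conjTranspose_add, conjTranspose_mul,
      conjTranspose_conjTranspose, Matrix.mul_assoc]
    exact Finset.sum_congr rfl fun _ _ => Finset.sum_congr rfl fun _ _ => add_comm _ _
  refine ⟨fun X => ?_, adjoint_comm, fun R μ h => ?_⟩
  · have deriv_eq : deriv (fun θ => transit (fun i => K i θ)) θ₀ =
        ∑ i, (K' i ⊗ₖ (K i θ₀).map (starRingEnd ℂ) + K i θ₀ ⊗ₖ (K' i).map (starRingEnd ℂ)) :=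
      (hasDerivAt_transit hK).deriv
    rw [deriv_eq, hΦ]
    simp only [transit, conjTranspose_sum, Finset.sum_mul, Finset.mul_sum, Matrix.mul_add,
      conjTranspose_kronecker_map_conj_mul, sum_mulVec, add_mulVec,
      kronecker_map_conj_mulVec_vecM, vecM_sum, vecM_add]
    exact Finset.sum_comm
  · rw [adjoint_comm, h, conjTranspose_smul]
    rfl

end
end

section
/- Let p, φ : ℝ → ℝ be continuously differentiable at θ₀ with 0 ≤ p(θ) ≤ 1 and p(θ₀) ∈ {0, 1}. For each θ define the channel E_θ(X) := (1−p(θ))·e^{−iφ(θ)σ_z/2} X e^{iφ(θ)σ_z/2} + p(θ)·σ_z e^{−iφ(θ)σ_z/2} X e^{iφ(θ)σ_z/2} σ_z on Matrix 2 2 ℂ. Fix 0 < α < 1/2 and let ρ₀ := (1/2)·I + α·(|0⟩⟨1| + |1⟩⟨0|), ρ_N(θ) := E_θ^N(ρ₀), and let F̃_N be the associated QFI of the Hermitian family θ ↦ ρ_N(θ). Then lim_{N→∞} F̃_N(θ₀)/N² = 8α²·(4ṗ² + φ̇²)/(1/2 + 2α²) − 64α⁴·ṗ²/(1/2 + 2α²)²,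 where ṗ = p′(θ₀) and φ̇ = φ′(θ₀); moreover this limit is strictly positive whenever (ṗ, φ̇) ≠ (0, 0). Hence the control-free sequential strategy achieves the Heisenberg limit at θ₀ when p(θ₀) ∈ {0,1} and (ṗ, φ̇) ≠ (0,0). -/
open Matrix Filter

noncomputable section

attribute [local instance] Matrix.frobeniusNormedAddCommGroup Matrix.frobeniusNormedSpace

/-- Pauli Z. -/
def sz : Matrix (Fin 2) (Fin 2) ℂ := !![1, 0; 0, -1]

/-- The rotation `e^{-iφσ_z/2} = diag(e^{-iφ/2}, e^{iφ/2})`. -/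
def rotz (φ : ℝ) : Matrix (Fin 2) (Fin 2) ℂ :=
  !![Complex.exp (-(Complex.I * φ) / 2), 0; 0, Complex.exp (Complex.I * φ / 2)]

/-- The dephased rotation channel. -/
def dephChan (p φ : ℝ) (X : Matrix (Fin 2) (Fin 2) ℂ) : Matrix (Fin 2) (Fin 2) ℂ :=
  ((1 - p : ℝ) : ℂ) • (rotz φ * X * (rotz φ)ᴴ)
    + ((p : ℝ) : ℂ) • (sz * rotz φ * X * (rotz φ)ᴴ * sz)

/-- Associated QFI of a differentiable family of Hermitian matrices. -/
def assocQFI (ρ : ℝ → Matrix (Fin 2) (Fin 2) ℂ) (θ₀ : ℝ) : ℂ :=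
  4 * ((deriv ρ θ₀ * deriv ρ θ₀).trace / (ρ θ₀ * ρ θ₀).trace
    - ((ρ θ₀ * deriv ρ θ₀).trace / (ρ θ₀ * ρ θ₀).trace) ^ 2)

theorem conjTranspose_rotz (φ : ℝ) :
    (rotz φ)ᴴ =
      !![Complex.exp (Complex.I * φ / 2), 0; 0, Complex.exp (-(Complex.I * φ) / 2)] := by
  ext i j
  fin_cases i <;> fin_cases j <;>
    simp [rotz, Matrix.conjTranspose_apply, ← Complex.exp_conj, map_ofNat]

/-- The dephased rotation fixes the diagonal and multiplies the coherences by
`(1 - 2p) e^{-iφ}` and its conjugate. -/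
theorem dephChan_of (p φ : ℝ) (a b c d : ℂ) :
    dephChan p φ !![a, b; c, d] =
      !![a, ((1 - 2 * p : ℝ) : ℂ) * Complex.exp (-(Complex.I * φ)) * b;
        ((1 - 2 * p : ℝ) : ℂ) * Complex.exp (Complex.I * φ) * c, d] := by
  have hsq₁ : Complex.exp (-(Complex.I * φ)) = Complex.exp (-(Complex.I * φ) / 2) ^ 2 := by
    rw [← Complex.exp_nat_mul]; congr 1; push_cast; ring
  have hsq₂ : Complex.exp (Complex.I * φ) = Complex.exp (Complex.I * φ / 2) ^ 2 := by
    rw [← Complex.exp_nat_mul]; congr 1; push_cast; ring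
  have hinv : Complex.exp (-(Complex.I * φ) / 2) * Complex.exp (Complex.I * φ / 2) = 1 := by
    rw [← Complex.exp_add, ← Complex.exp_zero]; congr 1; ring
  rw [hsq₁, hsq₂, dephChan, conjTranspose_rotz, rotz, sz]
  generalize Complex.exp (-(Complex.I * φ) / 2) = e at *
  generalize Complex.exp (Complex.I * φ / 2) = f at *
  ext i j
  fin_cases i <;> fin_cases j <;> simp
  · linear_combination a * hinv
  · ring
  · ring
  · linear_combination d * hinv

/-- The `N`-fold iterate of the dephased rotation. -/
theorem iterate_dephChan_of (p φ : ℝ) (a b c d : ℂ) (N : ℕ) :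
    (fun X => dephChan p φ X)^[N] !![a, b; c, d] =
      !![a, (((1 - 2 * p : ℝ) : ℂ) * Complex.exp (-(Complex.I * φ))) ^ N * b;
        (((1 - 2 * p : ℝ) : ℂ) * Complex.exp (Complex.I * φ)) ^ N * c, d] := by
  induction N with
  | zero => simp
  | succ N ih =>
    rw [Function.iterate_succ_apply', ih, dephChan_of]
    simp only [pow_succ', mul_assoc]

/-- Entrywise differentiation of a matrix family with constant diagonal. -/
theorem hasDerivAt_matrix_offDiag {u v : ℝ → ℂ} {u' v' : ℂ} {t : ℝ} (a d : ℂ)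
    (hu : HasDerivAt u u' t) (hv : HasDerivAt v v' t) :
    HasDerivAt (fun s => !![a, u s; v s, d]) !![0, u'; v', 0] t := by
  have h : HasDerivAt (fun s i j => (!![a, u s; v s, d] : Matrix (Fin 2) (Fin 2) ℂ) i j)
      (fun i j => (!![0, u'; v', 0] : Matrix (Fin 2) (Fin 2) ℂ) i j) t := by
    refine hasDerivAt_pi.2 fun i => hasDerivAt_pi.2 fun j => ?_
    fin_cases i <;> fin_cases j <;> simp [hu, hv, hasDerivAt_const]
  exact h

/-- The associated QFI of a family with constant diagonal and differentiable coherences. -/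
theorem assocQFI_offDiag {u v : ℝ → ℂ} {u' v' : ℂ} {t : ℝ} (a d : ℂ)
    (hu : HasDerivAt u u' t) (hv : HasDerivAt v v' t) :
    assocQFI (fun s => !![a, u s; v s, d]) t =
      4 * (2 * (u' * v') / (a ^ 2 + d ^ 2 + 2 * (u t * v t))
        - ((u t * v' + v t * u') / (a ^ 2 + d ^ 2 + 2 * (u t * v t))) ^ 2) := by
  have h₁ : (!![0, u'; v', 0] * !![0, u'; v', 0] : Matrix (Fin 2) (Fin 2) ℂ).trace
      = 2 * (u' * v') := by
    simp [Matrix.trace_fin_two]; ring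
  have h₂ : (!![a, u t; v t, d] * !![a, u t; v t, d] : Matrix (Fin 2) (Fin 2) ℂ).trace
      = a ^ 2 + d ^ 2 + 2 * (u t * v t) := by
    simp [Matrix.trace_fin_two]; ring
  have h₃ : (!![a, u t; v t, d] * !![0, u'; v', 0] : Matrix (Fin 2) (Fin 2) ℂ).trace
      = u t * v' + v t * u' := by
    simp [Matrix.trace_fin_two]
  have hderiv : deriv (fun s => !![a, u s; v s, d]) t = !![0, u'; v', 0] :=
    (hasDerivAt_matrix_offDiag a d hu hv).deriv
  rw [assocQFI, hderiv, h₁, h₂, h₃]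

/-- Derivative of the `N`-fold coherence factor, with `ε = ±I` selecting the matrix entry. -/
theorem hasDerivAt_coherence {p φ : ℝ → ℝ} {pd φd θ₀ : ℝ} (hp : HasDerivAt p pd θ₀)
    (hφ : HasDerivAt φ φd θ₀) (ε b : ℂ) (N : ℕ) :
    HasDerivAt (fun θ => (((1 - 2 * p θ : ℝ) : ℂ) * Complex.exp (ε * φ θ)) ^ N * b)
      (N * (((1 - 2 * p θ₀ : ℝ) : ℂ) * Complex.exp (ε * φ θ₀)) ^ (N - 1)
        * ((-(2 * pd) + (1 - 2 * p θ₀) * (ε * φd)) * Complex.exp (ε * φ θ₀)) * b) θ₀ := by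
  have hs : HasDerivAt (fun θ => ((1 - 2 * p θ : ℝ) : ℂ)) ((-(2 * pd) : ℝ) : ℂ) θ₀ :=
    ((hp.const_mul 2).const_sub 1).ofReal_comp
  have he := (hφ.ofReal_comp.const_mul ε).cexp
  refine (((hs.mul he).pow N).mul_const b).congr_deriv ?_
  simp only [Pi.mul_apply]
  push_cast
  ring

/-- At `p(θ₀) ∈ {0, 1}` the associated QFI after `N` uses is exactly quadratic in `N`. -/
theorem assocQFI_iterate_dephChan {p φ : ℝ → ℝ} {pd φd θ₀ : ℝ} (hp : HasDerivAt p pd θ₀)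
    (hφ : HasDerivAt φ φd θ₀) (hpθ₀ : p θ₀ = 0 ∨ p θ₀ = 1) (a b : ℂ) (N : ℕ) :
    assocQFI (fun θ => (fun X => dephChan (p θ) (φ θ) X)^[N] !![a, b; b, a]) θ₀ =
      N ^ 2 * (8 * b ^ 2 * (4 * pd ^ 2 + φd ^ 2) / (2 * a ^ 2 + 2 * b ^ 2)
        - 64 * b ^ 4 * pd ^ 2 / (2 * a ^ 2 + 2 * b ^ 2) ^ 2) := by
  have hu := hasDerivAt_coherence hp hφ (-Complex.I) b N
  have hv := hasDerivAt_coherence hp hφ Complex.I b N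
  simp only [neg_mul] at hu
  simp only [iterate_dephChan_of]
  rw [assocQFI_offDiag a a hu hv]
  rcases N with _ | m
  · simp
  have hinv : Complex.exp (-(Complex.I * φ θ₀)) * Complex.exp (Complex.I * φ θ₀) = 1 := by
    rw [← Complex.exp_add]; simp
  set e := Complex.exp (-(Complex.I * φ θ₀))
  set f := Complex.exp (Complex.I * φ θ₀)
  obtain ⟨s, hs, hs2⟩ : ∃ s : ℂ, ((1 - 2 * p θ₀ : ℝ) : ℂ) = s ∧ s ^ 2 = 1 := by
    refine ⟨_, rfl, ?_⟩
    rcases hpθ₀ with h | h <;> rw [h] <;> norm_num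
  have hs' : (1 - 2 * (p θ₀ : ℂ)) = s := by rw [← hs]; push_cast; ring
  simp only [hs, hs', Nat.add_sub_cancel]
  have hPQ : (s * e) ^ m * (s * f) ^ m = 1 := by
    rw [← mul_pow, show s * e * (s * f) = s ^ 2 * (e * f) by ring, hs2, hinv]; simp
  rw [pow_succ (s * e), pow_succ (s * f)]
  generalize (s * e) ^ m = P at *
  generalize (s * f) ^ m = Q at *
  have hPQef : P * Q * (e * f) = 1 := by rw [hPQ, hinv, one_mul]
  have huv : P * (s * e) * b * (Q * (s * f) * b) = b ^ 2 := by
    linear_combination b ^ 2 * s ^ 2 * hPQef + b ^ 2 * hs2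
  have hduv : ((m + 1 : ℕ) : ℂ) * P * ((-(2 * pd) + s * -(Complex.I * φd)) * e) * b
      * (((m + 1 : ℕ) : ℂ) * Q * ((-(2 * pd) + s * (Complex.I * φd)) * f) * b)
      = ((m + 1 : ℕ) : ℂ) ^ 2 * b ^ 2 * (4 * pd ^ 2 + φd ^ 2) := by
    linear_combination ((m + 1 : ℕ) : ℂ) ^ 2 * b ^ 2 *
      ((4 * pd ^ 2 - s ^ 2 * Complex.I ^ 2 * φd ^ 2) * hPQef
        - s ^ 2 * φd ^ 2 * Complex.I_sq + φd ^ 2 * hs2)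
  have hcross : P * (s * e) * b * (((m + 1 : ℕ) : ℂ) * Q
        * ((-(2 * pd) + s * (Complex.I * φd)) * f) * b)
      + Q * (s * f) * b * (((m + 1 : ℕ) : ℂ) * P * ((-(2 * pd) + s * -(Complex.I * φd)) * e) * b)
      = ((m + 1 : ℕ) : ℂ) * b ^ 2 * s * (-4 * pd) := by
    linear_combination ((m + 1 : ℕ) : ℂ) * b ^ 2 * s * (-4 * pd) * hPQef
  rw [huv, hduv, hcross, show a ^ 2 + a ^ 2 + 2 * b ^ 2 = 2 * a ^ 2 + 2 * b ^ 2 by ring]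
  generalize 2 * a ^ 2 + 2 * b ^ 2 = D
  linear_combination (-64 * ((m + 1 : ℕ) : ℂ) ^ 2 * b ^ 4 * pd ^ 2 / D ^ 2) * hs2

/-- Heisenberg limit for the dephased rotation channel at `p(θ₀) ∈ {0,1}`:
with input `ρ₀ = ½I + α(|0⟩⟨1| + |1⟩⟨0|)`, `0 < α < 1/2`, the associated QFI of
`ρ_N(θ) = E_θ^N(ρ₀)` satisfies
`F̃_N(θ₀)/N² → 8α²(4ṗ² + φ̇²)/(1/2 + 2α²) − 64α⁴ṗ²/(1/2 + 2α²)²`, which is positive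
whenever `(ṗ, φ̇) ≠ (0, 0)`. -/
theorem dephased_rotation_HL (θ₀ : ℝ) (p φ : ℝ → ℝ) (pd φd : ℝ)
    (hp : HasDerivAt p pd θ₀) (hφ : HasDerivAt φ φd θ₀)
    (hp01 : ∀ θ, 0 ≤ p θ ∧ p θ ≤ 1)
    (hpθ₀ : p θ₀ = 0 ∨ p θ₀ = 1)
    (α : ℝ) (hα : 0 < α ∧ α < 1 / 2)
    (ρ₀ : Matrix (Fin 2) (Fin 2) ℂ)
    (hρ₀ : ρ₀ = ((1 / 2 : ℝ) : ℂ) • (1 : Matrix (Fin 2) (Fin 2) ℂ)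
        + (α : ℂ) • (!![0, 1; 0, 0] + !![0, 0; 1, 0] : Matrix (Fin 2) (Fin 2) ℂ)) :
    Tendsto (fun N : ℕ =>
        assocQFI (fun θ => (fun X => dephChan (p θ) (φ θ) X)^[N] ρ₀) θ₀ / (N : ℂ) ^ 2)
      atTop
      (nhds (((8 * α ^ 2 * (4 * pd ^ 2 + φd ^ 2) / (1 / 2 + 2 * α ^ 2)
          - 64 * α ^ 4 * pd ^ 2 / (1 / 2 + 2 * α ^ 2) ^ 2 : ℝ)) : ℂ)) ∧
    ((pd ≠ 0 ∨ φd ≠ 0) →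
      0 < 8 * α ^ 2 * (4 * pd ^ 2 + φd ^ 2) / (1 / 2 + 2 * α ^ 2)
          - 64 * α ^ 4 * pd ^ 2 / (1 / 2 + 2 * α ^ 2) ^ 2) := by
  have hD : 0 < 1 / 2 + 2 * α ^ 2 := by positivity
  refine ⟨?_, fun h => ?_⟩
  · have hmat : ρ₀ = !![(1 / 2 : ℂ), (α : ℂ); (α : ℂ), (1 / 2 : ℂ)] := by
      rw [hρ₀]
      ext i j
      fin_cases i <;> fin_cases j <;> simp
    refine tendsto_const_nhds.congr' ?_
    filter_upwards [eventually_ne_atTop 0] with N hN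
    have hN' : (N : ℂ) ^ 2 ≠ 0 := by exact_mod_cast pow_ne_zero 2 hN
    rw [hmat, assocQFI_iterate_dephChan hp hφ hpθ₀, mul_div_cancel_left₀ _ hN']
    push_cast
    norm_num
  · have hrw : 8 * α ^ 2 * (4 * pd ^ 2 + φd ^ 2) / (1 / 2 + 2 * α ^ 2)
          - 64 * α ^ 4 * pd ^ 2 / (1 / 2 + 2 * α ^ 2) ^ 2
        = 16 * α ^ 2 * pd ^ 2 / (1 / 2 + 2 * α ^ 2) ^ 2
          + 8 * α ^ 2 * φd ^ 2 / (1 / 2 + 2 * α ^ 2) := by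
      field_simp
      ring
    rw [hrw]
    have hα0 := hα.1
    rcases h with h | h <;> positivity

end
end

section
/- Let p₁, p₂, p₃ ≥ 0 with p₁ + p₂ + p₃ ≤ 1, let W ∈ Matrix 4 4 ℂ be an arbitrary unitary, and define the noise Kraus operators K₁ := √(1−p₁−p₂−p₃)·W, K₂ := √p₁·W·(σ_x ⊗ σ_x), K₃ := √p₂·W·(σ_x ⊗ σ_y), K₄ := √p₃·W·(I₂ ⊗ σ_z). Then: (i) Σ_{i=1}^4 Kᵢ·(σ_x ⊗ I₂)·Kᵢ† = W·(σ_x ⊗ I₂)·W†. (ii) Consequently, for any unitary V ∈ Matrix 4 4 ℂ, setting X₀ := V†·(σ_x ⊗ I₂)·V and U_c := V†·W†, the controlled noisy evolution returns X₀: U_c·( Σ_{i=1}^4 Kᵢ·(V X₀ V†)·Kᵢ† )·U_c† = X₀. In particular, with V = U_t(θ₀) the unitary signal evolution at the true parameter value, the unitary control U_c = U_t(θ₀)†W† makes X₀ a fixed point of the controlled channel, establishing a decoherence-free direction without any ancilla. -/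
open Matrix
open scoped Kronecker

noncomputable section

/-- Pauli matrices. -/
def sx : Matrix (Fin 2) (Fin 2) ℂ := !![0, 1; 1, 0]
def sy : Matrix (Fin 2) (Fin 2) ℂ := !![0, -Complex.I; Complex.I, 0]
/-- Noise Kraus operators `K₁ = √(1−p₁−p₂−p₃) W`, `K₂ = √p₁ W(σ_x⊗σ_x)`,
`K₃ = √p₂ W(σ_x⊗σ_y)`, `K₄ = √p₃ W(I₂⊗σ_z)`. -/
def NK1 (p₁ p₂ p₃ : ℝ) (W : Matrix (Fin 2 × Fin 2) (Fin 2 × Fin 2) ℂ) :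
    Matrix (Fin 2 × Fin 2) (Fin 2 × Fin 2) ℂ :=
  (Real.sqrt (1 - p₁ - p₂ - p₃) : ℂ) • W
def NK2 (p₁ : ℝ) (W : Matrix (Fin 2 × Fin 2) (Fin 2 × Fin 2) ℂ) :
    Matrix (Fin 2 × Fin 2) (Fin 2 × Fin 2) ℂ :=
  (Real.sqrt p₁ : ℂ) • (W * (sx ⊗ₖ sx))
def NK3 (p₂ : ℝ) (W : Matrix (Fin 2 × Fin 2) (Fin 2 × Fin 2) ℂ) :
    Matrix (Fin 2 × Fin 2) (Fin 2 × Fin 2) ℂ :=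
  (Real.sqrt p₂ : ℂ) • (W * (sx ⊗ₖ sy))
def NK4 (p₃ : ℝ) (W : Matrix (Fin 2 × Fin 2) (Fin 2 × Fin 2) ℂ) :
    Matrix (Fin 2 × Fin 2) (Fin 2 × Fin 2) ℂ :=
  (Real.sqrt p₃ : ℂ) • (W * ((1 : Matrix (Fin 2) (Fin 2) ℂ) ⊗ₖ sz))

lemma smul_mul_conj_smul_sqrt {n : Type*} [Fintype n] {p : ℝ} (hp : 0 ≤ p)
    (A B : Matrix n n ℂ) :
    ((Real.sqrt p : ℂ) • A) * B * ((Real.sqrt p : ℂ) • A)ᴴ = (p : ℂ) • (A * B * Aᴴ) := by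
  have h : (Real.sqrt p : ℂ) * (Real.sqrt p : ℂ) = p := by
    exact_mod_cast Real.mul_self_sqrt hp
  simp only [conjTranspose_smul, Matrix.smul_mul, Matrix.mul_smul, smul_smul, RCLike.star_def,
    Complex.conj_ofReal, h]

lemma conj_mul_of_conj_eq {n : Type*} [Fintype n] {P X : Matrix n n ℂ}
    (h : P * X * Pᴴ = X) (W : Matrix n n ℂ) :
    (W * P) * X * (W * P)ᴴ = W * X * Wᴴ := by
  calc (W * P) * X * (W * P)ᴴ = W * (P * X * Pᴴ) * Wᴴ := by
        simp only [conjTranspose_mul, Matrix.mul_assoc]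
    _ = W * X * Wᴴ := by rw [h]

lemma sx_mul_conjTranspose : sx * sxᴴ = 1 := by
  ext i j
  fin_cases i <;> fin_cases j <;> simp [sx, mul_apply]

lemma sx_conj_sx : sx * sx * sxᴴ = sx := by
  rw [Matrix.mul_assoc, sx_mul_conjTranspose, Matrix.mul_one]

lemma sy_mul_conjTranspose : sy * syᴴ = 1 := by
  ext i j
  fin_cases i <;> fin_cases j <;> simp [sy, mul_apply]

lemma sz_mul_conjTranspose : sz * szᴴ = 1 := by
  ext i j
  fin_cases i <;> fin_cases j <;> simp [sz, mul_apply]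

/-- The noise channel maps `σ_x ⊗ I` to its conjugate by `W`. -/
lemma noise_channel_sx_kronecker_one {p₁ p₂ p₃ : ℝ}
    (h₁ : 0 ≤ p₁) (h₂ : 0 ≤ p₂) (h₃ : 0 ≤ p₃) (h : p₁ + p₂ + p₃ ≤ 1)
    (W : Matrix (Fin 2 × Fin 2) (Fin 2 × Fin 2) ℂ) :
    NK1 p₁ p₂ p₃ W * (sx ⊗ₖ (1 : Matrix (Fin 2) (Fin 2) ℂ)) * (NK1 p₁ p₂ p₃ W)ᴴ
      + NK2 p₁ W * (sx ⊗ₖ (1 : Matrix (Fin 2) (Fin 2) ℂ)) * (NK2 p₁ W)ᴴ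
      + NK3 p₂ W * (sx ⊗ₖ (1 : Matrix (Fin 2) (Fin 2) ℂ)) * (NK3 p₂ W)ᴴ
      + NK4 p₃ W * (sx ⊗ₖ (1 : Matrix (Fin 2) (Fin 2) ℂ)) * (NK4 p₃ W)ᴴ
      = W * (sx ⊗ₖ (1 : Matrix (Fin 2) (Fin 2) ℂ)) * Wᴴ := by
  have kron {A B : Matrix (Fin 2) (Fin 2) ℂ} (hA : A * sx * Aᴴ = sx) (hB : B * Bᴴ = 1) :
      (A ⊗ₖ B) * (sx ⊗ₖ (1 : Matrix (Fin 2) (Fin 2) ℂ)) * (A ⊗ₖ B)ᴴ = sx ⊗ₖ 1 := by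
    rw [conjTranspose_kronecker, ← mul_kronecker_mul, ← mul_kronecker_mul, hA,
      Matrix.mul_one, hB]
  rw [NK1, NK2, NK3, NK4, smul_mul_conj_smul_sqrt (by linarith), smul_mul_conj_smul_sqrt h₁,
    smul_mul_conj_smul_sqrt h₂, smul_mul_conj_smul_sqrt h₃,
    conj_mul_of_conj_eq (kron sx_conj_sx sx_mul_conjTranspose),
    conj_mul_of_conj_eq (kron sx_conj_sx sy_mul_conjTranspose),
    conj_mul_of_conj_eq (kron (by simp) sz_mul_conjTranspose),
    ← add_smul, ← add_smul, ← add_smul]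
  push_cast
  ring_nf
  rw [one_smul]

/-- The noise channel leaves `σ_x ⊗ I` invariant up to conjugation by the
unknown unitary `W`: (i) `Σᵢ Kᵢ (σ_x⊗I) Kᵢᴴ = W (σ_x⊗I) Wᴴ`; (ii) hence for any unitary `V`,
with `X₀ = Vᴴ(σ_x⊗I)V` and `U_c = VᴴWᴴ`, the controlled noisy evolution returns `X₀`. -/
theorem noise_decoherence_free_direction (p₁ p₂ p₃ : ℝ)
    (hp : 0 ≤ p₁ ∧ 0 ≤ p₂ ∧ 0 ≤ p₃ ∧ p₁ + p₂ + p₃ ≤ 1)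
    (W : Matrix (Fin 2 × Fin 2) (Fin 2 × Fin 2) ℂ)
    (hW : Wᴴ * W = 1) (hW' : W * Wᴴ = 1) :
    (NK1 p₁ p₂ p₃ W * (sx ⊗ₖ (1 : Matrix (Fin 2) (Fin 2) ℂ)) * (NK1 p₁ p₂ p₃ W)ᴴ
      + NK2 p₁ W * (sx ⊗ₖ (1 : Matrix (Fin 2) (Fin 2) ℂ)) * (NK2 p₁ W)ᴴ
      + NK3 p₂ W * (sx ⊗ₖ (1 : Matrix (Fin 2) (Fin 2) ℂ)) * (NK3 p₂ W)ᴴ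
      + NK4 p₃ W * (sx ⊗ₖ (1 : Matrix (Fin 2) (Fin 2) ℂ)) * (NK4 p₃ W)ᴴ
      = W * (sx ⊗ₖ (1 : Matrix (Fin 2) (Fin 2) ℂ)) * Wᴴ) ∧
    ∀ V : Matrix (Fin 2 × Fin 2) (Fin 2 × Fin 2) ℂ, Vᴴ * V = 1 → V * Vᴴ = 1 →
      ∀ X₀ Uc : Matrix (Fin 2 × Fin 2) (Fin 2 × Fin 2) ℂ,
        X₀ = Vᴴ * (sx ⊗ₖ (1 : Matrix (Fin 2) (Fin 2) ℂ)) * V → Uc = Vᴴ * Wᴴ →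
        Uc * (NK1 p₁ p₂ p₃ W * (V * X₀ * Vᴴ) * (NK1 p₁ p₂ p₃ W)ᴴ
            + NK2 p₁ W * (V * X₀ * Vᴴ) * (NK2 p₁ W)ᴴ
            + NK3 p₂ W * (V * X₀ * Vᴴ) * (NK3 p₂ W)ᴴ
            + NK4 p₃ W * (V * X₀ * Vᴴ) * (NK4 p₃ W)ᴴ) * Ucᴴ = X₀ := by
  obtain ⟨h₁, h₂, h₃, h⟩ := hp
  have key := noise_channel_sx_kronecker_one h₁ h₂ h₃ h W
  refine ⟨key, ?_⟩
  rintro V - hV' X₀ Uc rfl rfl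
  have hX : V * (Vᴴ * (sx ⊗ₖ (1 : Matrix (Fin 2) (Fin 2) ℂ)) * V) * Vᴴ = sx ⊗ₖ 1 := by
    calc _ = (V * Vᴴ) * (sx ⊗ₖ (1 : Matrix (Fin 2) (Fin 2) ℂ)) * (V * Vᴴ) := by
          simp only [Matrix.mul_assoc]
      _ = _ := by rw [hV', Matrix.one_mul, Matrix.mul_one]
  rw [hX, key, conjTranspose_mul, conjTranspose_conjTranspose, conjTranspose_conjTranspose]
  calc _ = Vᴴ * ((Wᴴ * W) * (sx ⊗ₖ (1 : Matrix (Fin 2) (Fin 2) ℂ)) * (Wᴴ * W)) * V := by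
        simp only [Matrix.mul_assoc]
    _ = _ := by rw [hW, Matrix.one_mul, Matrix.mul_one]

end
end

section
/- Order the two-qubit basis as (|00⟩, |01⟩, |10⟩, |11⟩). For i = 1,2,3,4 let φᵢ ∈ ℝ and Wᵢ := [[1,0,0,0],[0,e^{iφᵢ},0,0],[0,0,0,e^{iφᵢ}],[0,0,1,0]]. Let p₁, p₂, p₃ ≥ 0 with p₁+p₂+p₃ ≤ 1 and define the noise Kraus operators K₁ := √(1−p₁−p₂−p₃)·W₁, K₂ := √p₁·W₂·(σ_x ⊗ σ_x), K₃ := √p₂·W₃·(σ_x ⊗ σ_y), K₄ := √p₃·W₄·(I₂ ⊗ σ_z). Let R̃ := |01⟩⟨11| + |10⟩⟨00| and let C := [[1,0,0,0],[0,1,0,0],[0,0,0,1],[0,0,1,0]] be the CNOT gate. Then Σ_{i=1}^4 Kᵢ·R̃·Kᵢ† = C†·R̃·C, and likewise Σ_{i=1}^4 Kᵢ·R̃†·Kᵢ† = C†·R̃†·C: the action of the noise channel on the matrices R̃ and R̃† coincides with conjugation by the CNOT unitary, so the unitary control reversing the noise on this subspace can be taken to be CNOT. -/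
open Matrix

noncomputable section

/-- `σ_x ⊗ σ_x` as an explicit 4×4 matrix in the ordered basis `(|00⟩,|01⟩,|10⟩,|11⟩)`. -/
def sxx : Matrix (Fin 4) (Fin 4) ℂ :=
  !![0, 0, 0, 1; 0, 0, 1, 0; 0, 1, 0, 0; 1, 0, 0, 0]

/-- `σ_x ⊗ σ_y` as an explicit 4×4 matrix. -/
def sxy : Matrix (Fin 4) (Fin 4) ℂ :=
  !![0, 0, 0, -Complex.I; 0, 0, Complex.I, 0; 0, -Complex.I, 0, 0; Complex.I, 0, 0, 0]

/-- `I₂ ⊗ σ_z` as an explicit 4×4 matrix. -/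
def isz : Matrix (Fin 4) (Fin 4) ℂ :=
  !![1, 0, 0, 0; 0, -1, 0, 0; 0, 0, 1, 0; 0, 0, 0, -1]

/-- The unitary `Wᵢ` with phase `φ`. -/
def Wmat (φ : ℝ) : Matrix (Fin 4) (Fin 4) ℂ :=
  !![1, 0, 0, 0;
     0, Complex.exp (Complex.I * φ), 0, 0;
     0, 0, 0, Complex.exp (Complex.I * φ);
     0, 0, 1, 0]

/-- `R̃ = |01⟩⟨11| + |10⟩⟨00|`. -/
def Rt : Matrix (Fin 4) (Fin 4) ℂ :=
  !![0, 0, 0, 0; 0, 0, 0, 1; 1, 0, 0, 0; 0, 0, 0, 0]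

/-- The CNOT gate. -/
def CNOT : Matrix (Fin 4) (Fin 4) ℂ :=
  !![1, 0, 0, 0; 0, 1, 0, 0; 0, 0, 0, 1; 0, 0, 1, 0]

lemma sxx_conj_Rt : sxx * Rt * sxxᴴ = Rt := by
  ext i j
  fin_cases i <;> fin_cases j <;> simp [sxx, Rt, Matrix.mul_apply, Fin.sum_univ_four]

lemma sxy_conj_Rt : sxy * Rt * sxyᴴ = Rt := by
  ext i j
  fin_cases i <;> fin_cases j <;> simp [sxy, Rt, Matrix.mul_apply, Fin.sum_univ_four]

lemma isz_conj_Rt : isz * Rt * iszᴴ = Rt := by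
  ext i j
  fin_cases i <;> fin_cases j <;> simp [isz, Rt, Matrix.mul_apply, Fin.sum_univ_four]

lemma Wmat_conj_Rt (φ : ℝ) : Wmat φ * Rt * (Wmat φ)ᴴ = CNOTᴴ * Rt * CNOT := by
  have hφ : Complex.exp (Complex.I * φ) * Complex.exp (-(Complex.I * φ)) = 1 := by
    rw [← Complex.exp_add, add_neg_cancel, Complex.exp_zero]
  ext i j
  fin_cases i <;> fin_cases j <;>
    simp [Wmat, CNOT, Rt, Matrix.mul_apply, Fin.sum_univ_four, ← Complex.exp_conj, hφ]

lemma Wmat_mul_conj_Rt (φ : ℝ) {U : Matrix (Fin 4) (Fin 4) ℂ} (hU : U * Rt * Uᴴ = Rt) :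
    (Wmat φ * U) * Rt * (Wmat φ * U)ᴴ = CNOTᴴ * Rt * CNOT := by
  rw [← Wmat_conj_Rt φ, conjTranspose_mul]
  conv_rhs => rw [← hU]
  simp only [Matrix.mul_assoc]

lemma sqrt_smul_conj {n : Type*} [Fintype n] {p : ℝ} (hp : 0 ≤ p) (A X : Matrix n n ℂ) :
    ((Real.sqrt p : ℂ) • A) * X * ((Real.sqrt p : ℂ) • A)ᴴ = (p : ℂ) • (A * X * Aᴴ) := by
  rw [conjTranspose_smul, Matrix.smul_mul, Matrix.smul_mul, Matrix.mul_smul, smul_smul,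
    Complex.star_def, Complex.conj_ofReal, ← Complex.ofReal_mul, Real.mul_self_sqrt hp]

/-- The action of the noise channel with Kraus operators
`K₁ = √(1−p₁−p₂−p₃) W₁`, `K₂ = √p₁ W₂(σ_x⊗σ_x)`, `K₃ = √p₂ W₃(σ_x⊗σ_y)`,
`K₄ = √p₃ W₄(I₂⊗σ_z)` on `R̃` and `R̃†` coincides with conjugation by CNOT. -/
theorem noise_acts_as_CNOT (φ₁ φ₂ φ₃ φ₄ : ℝ) (p₁ p₂ p₃ : ℝ)
    (hp : 0 ≤ p₁ ∧ 0 ≤ p₂ ∧ 0 ≤ p₃ ∧ p₁ + p₂ + p₃ ≤ 1)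
    (K₁ K₂ K₃ K₄ : Matrix (Fin 4) (Fin 4) ℂ)
    (hK₁ : K₁ = (Real.sqrt (1 - p₁ - p₂ - p₃) : ℂ) • Wmat φ₁)
    (hK₂ : K₂ = (Real.sqrt p₁ : ℂ) • (Wmat φ₂ * sxx))
    (hK₃ : K₃ = (Real.sqrt p₂ : ℂ) • (Wmat φ₃ * sxy))
    (hK₄ : K₄ = (Real.sqrt p₃ : ℂ) • (Wmat φ₄ * isz)) :
    (K₁ * Rt * K₁ᴴ + K₂ * Rt * K₂ᴴ + K₃ * Rt * K₃ᴴ + K₄ * Rt * K₄ᴴ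
      = CNOTᴴ * Rt * CNOT) ∧
    (K₁ * Rtᴴ * K₁ᴴ + K₂ * Rtᴴ * K₂ᴴ + K₃ * Rtᴴ * K₃ᴴ + K₄ * Rtᴴ * K₄ᴴ
      = CNOTᴴ * Rtᴴ * CNOT) := by
  obtain ⟨hp₁, hp₂, hp₃, hp⟩ := hp
  have hR : K₁ * Rt * K₁ᴴ + K₂ * Rt * K₂ᴴ + K₃ * Rt * K₃ᴴ + K₄ * Rt * K₄ᴴ
      = CNOTᴴ * Rt * CNOT := by
    rw [hK₁, hK₂, hK₃, hK₄, sqrt_smul_conj (by linarith), sqrt_smul_conj hp₁,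
      sqrt_smul_conj hp₂, sqrt_smul_conj hp₃, Wmat_conj_Rt, Wmat_mul_conj_Rt φ₂ sxx_conj_Rt,
      Wmat_mul_conj_Rt φ₃ sxy_conj_Rt, Wmat_mul_conj_Rt φ₄ isz_conj_Rt,
      ← add_smul, ← add_smul, ← add_smul]
    push_cast
    ring_nf
    exact one_smul ℂ _
  refine ⟨hR, ?_⟩
  simpa only [conjTranspose_add, conjTranspose_mul, conjTranspose_conjTranspose,
    ← Matrix.mul_assoc] using congrArg conjTranspose hR

end
end
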